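/- Suppose τ* ∈ (0,∞) maximizes over τ ∈ [0,∞) the function G(τ) := τ²·E_{Y ∼ N(τ,1)}[(1/(exp(2τY)+1))²]. Let π* be the two-point prior on ℝ with π*({τ*}) = π*({−τ*}) = 1/2. Then π* is least favorable for mean square regret in the Gaussian experiment: for every probability measure π on ℝ, the minimal Bayes mean square regret under π does not exceed that under π*, i.e. inf over measurable δ : ℝ → [0,1] of ∫ R_sq(δ, τ) dπ(τ) ≤ inf over measurable δ : ℝ → [0,1] of ∫ R_sq(δ, τ) dπ*(τ), where R_sq(δ, τ) := τ²·∫ (𝟙{τ ≥ 0} − δ(y))² dN(τ,1)(y). -/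

import Mathlib

open MeasureTheory ProbabilityTheory

/-- Mean square regret of a rule `δ` at state `τ` in the Gaussian experiment `N(τ,1)`. -/
noncomputable def Rsq (δ : ℝ → ℝ) (τ : ℝ) : ℝ :=
  τ ^ 2 * ∫ y, ((if 0 ≤ τ then (1:ℝ) else 0) - δ y) ^ 2 ∂(gaussianReal τ 1)

/-- The minimal Bayes mean square regret under the prior `π`: the infimum over
measurable `[0,1]`-valued rules `δ` of `∫ R_sq(δ, τ) dπ(τ)`. -/
noncomputable def minBayesRisk (π : Measure ℝ) : ℝ :=
  sInf {r : ℝ | ∃ δ : ℝ → ℝ, Measurable δ ∧ (∀ y, δ y ∈ Set.Icc (0:ℝ) 1) ∧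
    r = ∫ τ, Rsq δ τ ∂π}

/-- The symmetric two-point prior putting mass `1/2` on each of `τ*` and `−τ*`. -/
noncomputable def twoPointPrior (τs : ℝ) : Measure ℝ :=
  (2:ENNReal)⁻¹ • Measure.dirac τs + (2:ENNReal)⁻¹ • Measure.dirac (-τs)

/-- The logistic weight `1 / (exp (2u) + 1)`. -/
noncomputable def logisticWeight (u : ℝ) : ℝ := 1 / (Real.exp (2 * u) + 1)

lemma logisticWeight_pos (u : ℝ) : 0 < logisticWeight u := by
  unfold logisticWeight; positivity

lemma logisticWeight_lt_one (u : ℝ) : logisticWeight u < 1 := by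
  unfold logisticWeight
  rw [div_lt_one (by positivity)]
  linarith [Real.exp_pos (2 * u)]

lemma logisticWeight_neg (u : ℝ) : logisticWeight (-u) = 1 - logisticWeight u := by
  unfold logisticWeight
  have h : Real.exp (2 * -u) = (Real.exp (2 * u))⁻¹ := by rw [← Real.exp_neg]; ring_nf
  have := Real.exp_pos (2 * u)
  rw [h]
  field_simp
  ring

@[fun_prop]
lemma continuous_logisticWeight : Continuous logisticWeight := by
  unfold logisticWeight
  fun_prop (disch := intro x; positivity)

@[fun_prop]
lemma measurable_logisticWeight : Measurable logisticWeight :=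
  continuous_logisticWeight.measurable

lemma antitone_logisticWeight : Antitone logisticWeight := by
  intro x y h
  unfold logisticWeight
  gcongr

lemma hasDerivAt_logisticWeight_sq (u : ℝ) :
    HasDerivAt (fun u => logisticWeight u ^ 2)
      (-4 * (logisticWeight u ^ 2 * (1 - logisticWeight u))) u := by
  unfold logisticWeight
  have h1 : HasDerivAt (fun u : ℝ => Real.exp (2 * u) + 1) (Real.exp (2 * u) * 2) u := by
    have := ((hasDerivAt_id u).const_mul 2).exp.add_const 1
    simpa using this
  have h2 := (((hasDerivAt_const u (1 : ℝ)).div h1 (by positivity)).pow 2)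
  refine h2.congr_deriv ?_
  have hE : Real.exp (2 * u) + 1 ≠ 0 := by positivity
  simp only [Pi.div_apply, Nat.cast_ofNat, Nat.add_one_sub_one, pow_one]
  field_simp
  ring

lemma abs_logisticWeight_sq_mul_le (u : ℝ) :
    |logisticWeight u ^ 2 * (1 - logisticWeight u)| ≤ 1 := by
  have h0 := logisticWeight_pos u
  have h1 := logisticWeight_lt_one u
  rw [abs_of_nonneg (mul_nonneg (sq_nonneg _) (by linarith))]
  exact mul_le_one₀ (pow_le_one₀ h0.le h1.le) (by linarith) (by linarith)

/-- A bounded measurable function is Gaussian integrable. -/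
lemma integrable_gaussianReal_of_bounded {f : ℝ → ℝ} (hf : Measurable f) (C : ℝ)
    (hC : ∀ y, |f y| ≤ C) (t : ℝ) : Integrable f (gaussianReal t 1) :=
  Integrable.of_bound hf.aestronglyMeasurable C (Filter.Eventually.of_forall hC)

lemma integrable_logisticWeight_sq {p : ℝ → ℝ} (hp : Measurable p) (t : ℝ) :
    Integrable (fun z => logisticWeight (p z) ^ 2) (gaussianReal t 1) := by
  refine integrable_gaussianReal_of_bounded (by fun_prop) 1 (fun y => ?_) t
  rw [abs_of_nonneg (sq_nonneg _)]
  exact pow_le_one₀ (logisticWeight_pos _).le (logisticWeight_lt_one _).le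

lemma integral_gaussianReal_eq_shift {f : ℝ → ℝ} (hf : Measurable f) (t : ℝ) :
    ∫ y, f y ∂(gaussianReal t 1) = ∫ z, f (z + t) ∂(gaussianReal 0 1) := by
  have h := gaussianReal_map_add_const (μ := 0) (v := 1) t
  rw [zero_add] at h
  rw [← h, integral_map (by fun_prop) hf.aestronglyMeasurable]

lemma hasDerivAt_integral_logisticWeight_sq {p p' : ℝ → ℝ → ℝ} {b : ℝ → ℝ} (t : ℝ)
    (hp : ∀ s, Measurable (p s)) (hp' : Measurable (p' t))
    (hd : ∀ z s, HasDerivAt (fun s => p s z) (p' s z) s)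
    (hb : ∀ z, ∀ s ∈ Metric.ball t 1, |p' s z| ≤ b z)
    (hbi : Integrable b (gaussianReal 0 1)) :
    HasDerivAt (fun s => ∫ z, logisticWeight (p s z) ^ 2 ∂(gaussianReal 0 1))
      (∫ z, -4 * (logisticWeight (p t z) ^ 2 * (1 - logisticWeight (p t z))) * p' t z
        ∂(gaussianReal 0 1)) t := by
  refine (hasDerivAt_integral_of_dominated_loc_of_deriv_le
    (F := fun s z => logisticWeight (p s z) ^ 2)
    (F' := fun s z => -4 * (logisticWeight (p s z) ^ 2 * (1 - logisticWeight (p s z))) * p' s z)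
    (bound := fun z => 4 * b z)
    (Metric.ball_mem_nhds t one_pos) ?_ ?_ ?_ ?_ (hbi.const_mul 4) ?_).2
  · exact Filter.Eventually.of_forall fun s =>
      (integrable_logisticWeight_sq (hp s) 0).aestronglyMeasurable
  · exact integrable_logisticWeight_sq (hp t) 0
  · have := hp t
    exact Measurable.aestronglyMeasurable (by fun_prop)
  · refine Filter.Eventually.of_forall fun z s hs => ?_
    rw [Real.norm_eq_abs, abs_mul, abs_mul]
    have h1 := abs_logisticWeight_sq_mul_le (p s z)
    have h2 := hb z s hs
    have h3 : |(-4 : ℝ)| = 4 := by norm_num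
    rw [h3]
    exact mul_le_mul (by linarith) h2 (abs_nonneg _) (by norm_num)
  · exact Filter.Eventually.of_forall fun z s _ =>
      HasDerivAt.comp (h₂ := fun u => logisticWeight u ^ 2) s
        (hasDerivAt_logisticWeight_sq (p s z)) (hd z s)

/-- Mean square regret at `t ≥ 0` of the logistic rule with slope `c`. -/
noncomputable def logisticRegret (c t : ℝ) : ℝ :=
  t ^ 2 * ∫ y, logisticWeight (c * y) ^ 2 ∂(gaussianReal t 1)

/-- The logistic rule `y ↦ 1 / (exp (-2cy) + 1)`. -/
noncomputable def logisticRule (c y : ℝ) : ℝ := 1 - logisticWeight (c * y)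

lemma measurable_logisticRule (c : ℝ) : Measurable (logisticRule c) := by
  unfold logisticRule; fun_prop

lemma logisticRule_mem_Icc (c y : ℝ) : logisticRule c y ∈ Set.Icc (0 : ℝ) 1 := by
  unfold logisticRule
  constructor <;> linarith [logisticWeight_pos (c * y), logisticWeight_lt_one (c * y)]

lemma logisticRegret_nonneg (c t : ℝ) : 0 ≤ logisticRegret c t :=
  mul_nonneg (sq_nonneg _) (integral_nonneg fun _ => sq_nonneg _)

lemma rsq_logisticRule_of_nonneg (c : ℝ) {t : ℝ} (ht : 0 ≤ t) :
    Rsq (logisticRule c) t = logisticRegret c t := by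
  simp [Rsq, logisticRegret, logisticRule, ht]

lemma rsq_logisticRule_neg (c : ℝ) {t : ℝ} (ht : 0 < t) :
    Rsq (logisticRule c) (-t) = logisticRegret c t := by
  have hm := measurable_logisticRule c
  rw [Rsq, logisticRegret, if_neg (by linarith), neg_sq, ← gaussianReal_map_neg,
    integral_map (by fun_prop) (Measurable.aestronglyMeasurable (by fun_prop))]
  congr 2
  ext y
  rw [logisticRule, mul_neg, logisticWeight_neg]
  ring

lemma gaussianPDFReal_one_eq_exp_mul (s t y : ℝ) :
    gaussianPDFReal s 1 y =
      Real.exp ((s - t) * y - (s ^ 2 - t ^ 2) / 2) * gaussianPDFReal t 1 y := by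
  simp only [gaussianPDFReal]
  rw [mul_left_comm, ← Real.exp_add]
  congr 2
  simp only [NNReal.coe_one]
  ring

lemma integrable_gaussianPDFReal_mul {f : ℝ → ℝ} (hf : Measurable f) (C : ℝ)
    (hC : ∀ y, |f y| ≤ C) (t : ℝ) : Integrable (fun y => gaussianPDFReal t 1 y * f y) :=
  (integrable_gaussianPDFReal t 1).mul_bdd hf.aestronglyMeasurable (Filter.Eventually.of_forall hC)

lemma integral_gaussianReal_one (f : ℝ → ℝ) (t : ℝ) :
    ∫ y, f y ∂(gaussianReal t 1) = ∫ y, gaussianPDFReal t 1 y * f y := by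
  simpa using integral_gaussianReal_eq_integral_smul (μ := t) (v := 1) (f := f) one_ne_zero

/-- The Bayes risk of the two-point prior at `±t` is bounded below by the regret of the
logistic rule with slope `t`. -/
lemma two_mul_logisticRegret_le {δ : ℝ → ℝ} (hδ : Measurable δ)
    (hδ' : ∀ y, δ y ∈ Set.Icc (0 : ℝ) 1) {t : ℝ} (ht : 0 < t) :
    2 * logisticRegret t t ≤ Rsq δ t + Rsq δ (-t) := by
  have key : ∀ (e : ℝ → ℝ), Measurable e → (∀ y, e y ∈ Set.Icc (0 : ℝ) 1) →
      Rsq e t + Rsq e (-t) = t ^ 2 * ∫ y, (gaussianPDFReal t 1 y * (1 - e y) ^ 2 +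
        gaussianPDFReal (-t) 1 y * (0 - e y) ^ 2) ∧
      Integrable (fun y => gaussianPDFReal t 1 y * (1 - e y) ^ 2 +
        gaussianPDFReal (-t) 1 y * (0 - e y) ^ 2) := by
    intro e he he'
    have i1 := integrable_gaussianPDFReal_mul (f := fun y => (1 - e y) ^ 2) (by fun_prop) 1
      (fun y => by
        obtain ⟨h0, h1⟩ := he' y
        rw [abs_of_nonneg (sq_nonneg _)]
        exact pow_le_one₀ (by linarith) (by linarith)) t
    have i2 := integrable_gaussianPDFReal_mul (f := fun y => (0 - e y) ^ 2) (by fun_prop) 1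
      (fun y => by
        obtain ⟨h0, h1⟩ := he' y
        rw [abs_of_nonneg (sq_nonneg _), zero_sub, neg_sq]
        exact pow_le_one₀ (by linarith) (by linarith)) (-t)
    refine ⟨?_, i1.add i2⟩
    rw [integral_add i1 i2, Rsq, Rsq, if_pos ht.le, if_neg (by linarith),
      integral_gaussianReal_one, integral_gaussianReal_one]
    ring
  have e0 : 2 * logisticRegret t t = Rsq (logisticRule t) t + Rsq (logisticRule t) (-t) := by
    rw [rsq_logisticRule_of_nonneg t ht.le, rsq_logisticRule_neg t ht]; ring
  obtain ⟨e1, i1⟩ := key _ (measurable_logisticRule t) (logisticRule_mem_Icc t)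
  obtain ⟨e2, i2⟩ := key δ hδ hδ'
  rw [e0, e1, e2]
  refine mul_le_mul_of_nonneg_left (integral_mono i1 i2 fun y => ?_) (sq_nonneg t)
  have hP : gaussianPDFReal t 1 y = Real.exp (2 * (t * y)) * gaussianPDFReal (-t) 1 y := by
    rw [gaussianPDFReal_one_eq_exp_mul t (-t)]
    ring_nf
  have hQ := gaussianPDFReal_pos (-t) 1 y one_ne_zero
  simp only [hP, logisticRule, logisticWeight]
  generalize gaussianPDFReal (-t) 1 y = Q at hQ
  have hE := Real.exp_pos (2 * (t * y))
  generalize Real.exp (2 * (t * y)) = E at hE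
  have : E * Q * (1 - δ y) ^ 2 + Q * (0 - δ y) ^ 2 - (E * Q * (1 - (1 - 1 / (E + 1))) ^ 2 +
      Q * (0 - (1 - 1 / (E + 1))) ^ 2) = Q / (E + 1) * (E * (1 - δ y) - δ y) ^ 2 := by
    field_simp
    ring
  have h2 : 0 ≤ Q / (E + 1) * (E * (1 - δ y) - δ y) ^ 2 := by positivity
  linarith

lemma logisticRegret_self_le (c : ℝ) {t : ℝ} (ht : 0 < t) :
    logisticRegret t t ≤ logisticRegret c t := by
  have := two_mul_logisticRegret_le (measurable_logisticRule c) (logisticRule_mem_Icc c) ht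
  rw [rsq_logisticRule_of_nonneg c ht.le, rsq_logisticRule_neg c ht] at this
  linarith

lemma differentiable_logisticRegret_self : Differentiable ℝ fun t => logisticRegret t t := by
  intro t
  have e : (fun t => logisticRegret t t) =
      fun t => t ^ 2 * ∫ z, logisticWeight (t * (z + t)) ^ 2 ∂(gaussianReal 0 1) := by
    ext t
    rw [logisticRegret, integral_gaussianReal_eq_shift (by fun_prop)]
  rw [e]
  have h := hasDerivAt_integral_logisticWeight_sq (p := fun s z => s * (z + s))
    (p' := fun s z => z + 2 * s) (b := fun z => |z| + 2 * (|t| + 1)) t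
    (fun s => by fun_prop) (by fun_prop) (fun z s => by
      have := (hasDerivAt_id s).mul ((hasDerivAt_id s).const_add z)
      refine this.congr_deriv ?_
      simp only [id]; ring) (fun z s hs => by
      rw [Metric.mem_ball, Real.dist_eq] at hs
      have h1 := abs_add_le z (2 * s)
      have h2 := abs_sub_abs_le_abs_sub s t
      rw [abs_mul, abs_two] at h1
      linarith) (by
      have h1 : Integrable (fun z : ℝ => z) (gaussianReal 0 1) :=
        memLp_one_iff_integrable.1 (memLp_id_gaussianReal (μ := 0) (v := 1) 1)
      exact h1.abs.add (integrable_const _))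
  exact (differentiableAt_id.pow 2).mul h.differentiableAt

/-- Up to the factor `2t`, the derivative of `logisticRegret c` at `t`. -/
noncomputable def logisticScore (c t : ℝ) : ℝ :=
  ∫ y, logisticWeight (c * y) ^ 2 * (1 - 2 * c * t * (1 - logisticWeight (c * y)))
    ∂(gaussianReal t 1)

lemma hasDerivAt_logisticRegret (c t : ℝ) :
    HasDerivAt (logisticRegret c) (2 * t * logisticScore c t) t := by
  have e : logisticRegret c =
      fun t => t ^ 2 * ∫ z, logisticWeight (c * (z + t)) ^ 2 ∂(gaussianReal 0 1) := by
    ext t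
    rw [logisticRegret, integral_gaussianReal_eq_shift (by fun_prop)]
  rw [e]
  have h := hasDerivAt_integral_logisticWeight_sq (p := fun s z => c * (z + s))
    (p' := fun _ _ => c) (b := fun _ => |c|) t
    (fun s => by fun_prop) (by fun_prop) (fun z s => by
      simpa using ((hasDerivAt_id s).const_add z).const_mul c) (fun _ _ _ => le_rfl)
    (integrable_const _)
  refine ((hasDerivAt_pow 2 t).mul h).congr_deriv ?_
  have i1 := integrable_logisticWeight_sq (p := fun z => c * (z + t)) (by fun_prop) 0
  have i2 : Integrable (fun z => logisticWeight (c * (z + t)) ^ 2 *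
      (1 - logisticWeight (c * (z + t)))) (gaussianReal 0 1) :=
    integrable_gaussianReal_of_bounded (by fun_prop) 1
      (fun y => abs_logisticWeight_sq_mul_le _) 0
  have e2 : logisticScore c t = (∫ z, logisticWeight (c * (z + t)) ^ 2 ∂(gaussianReal 0 1)) -
      2 * c * t * ∫ z, logisticWeight (c * (z + t)) ^ 2 *
        (1 - logisticWeight (c * (z + t))) ∂(gaussianReal 0 1) := by
    rw [logisticScore, integral_gaussianReal_eq_shift (by fun_prop), ← integral_const_mul,
      ← integral_sub i1 (i2.const_mul _)]
    congr 1
    ext z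
    ring
  rw [e2, integral_mul_const, integral_const_mul]
  simp only [Nat.cast_ofNat, Nat.add_one_sub_one, pow_one]
  ring

/-- A weight that crosses zero once from above integrates against a Gaussian shift with the
sign opposite to that of the shift, if it integrates to zero without the shift. -/
lemma mul_integral_gaussianReal_nonpos {f : ℝ → ℝ} (hf : Measurable f) (C : ℝ)
    (hC : ∀ y, |f y| ≤ C) (a y₀ : ℝ) (h₁ : ∀ y ≤ y₀, 0 ≤ f y) (h₂ : ∀ y, y₀ ≤ y → f y ≤ 0)
    (h0 : ∫ y, f y ∂(gaussianReal a 1) = 0) (t : ℝ) :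
    (t - a) * ∫ y, f y ∂(gaussianReal t 1) ≤ 0 := by
  rw [integral_gaussianReal_one] at h0 ⊢
  set K := Real.exp ((t - a) * y₀ - (t ^ 2 - a ^ 2) / 2) with hK
  have ia := integrable_gaussianPDFReal_mul hf C hC a
  have it := integrable_gaussianPDFReal_mul hf C hC t
  have h : ∫ y, (t - a) * (gaussianPDFReal t 1 y * f y - K * (gaussianPDFReal a 1 y * f y)) ≤ 0 := by
    refine integral_nonpos fun y => ?_
    have hP := gaussianPDFReal_nonneg a 1 y
    simp only [Pi.zero_apply]
    rw [gaussianPDFReal_one_eq_exp_mul t a y]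
    have hmain : (t - a) * (Real.exp ((t - a) * y - (t ^ 2 - a ^ 2) / 2) - K) * f y ≤ 0 := by
      rcases le_total y y₀ with hy | hy
      · refine mul_nonpos_of_nonpos_of_nonneg ?_ (h₁ y hy)
        rcases le_total a t with hat | hat
        · refine mul_nonpos_of_nonneg_of_nonpos (by linarith) (sub_nonpos.2 ?_)
          exact Real.exp_le_exp.2 (by nlinarith)
        · refine mul_nonpos_of_nonpos_of_nonneg (by linarith) (sub_nonneg.2 ?_)
          exact Real.exp_le_exp.2 (by nlinarith)
      · refine mul_nonpos_of_nonneg_of_nonpos ?_ (h₂ y hy)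
        rcases le_total a t with hat | hat
        · refine mul_nonneg (by linarith) (sub_nonneg.2 ?_)
          exact Real.exp_le_exp.2 (by nlinarith)
        · refine mul_nonneg_of_nonpos_of_nonpos (by linarith) (sub_nonpos.2 ?_)
          exact Real.exp_le_exp.2 (by nlinarith)
    nlinarith [mul_nonpos_of_nonpos_of_nonneg hmain hP]
  rw [integral_const_mul, integral_sub it (ia.const_mul K), integral_const_mul, h0] at h
  simpa using h

lemma mul_logisticScore_nonpos {a : ℝ} (ha : 0 < a) (h0 : logisticScore a a = 0) {t : ℝ} :
    (t - a) * logisticScore a t ≤ 0 := by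
  set k : ℝ → ℝ := fun y => 1 - 2 * a * a * (1 - logisticWeight (a * y)) with hk
  have hkc : Continuous k := by fun_prop
  have hka : Antitone k := by
    intro x y hxy
    have := antitone_logisticWeight (mul_le_mul_of_nonneg_left hxy ha.le)
    have : 2 * a * a * (1 - logisticWeight (a * x)) ≤ 2 * a * a * (1 - logisticWeight (a * y)) := by
      gcongr
    simp only [hk]; linarith
  set f : ℝ → ℝ := fun y => logisticWeight (a * y) ^ 2 * k y with hf
  have hfm : Measurable f := by fun_prop
  have hfC : ∀ y, |f y| ≤ 1 + 2 * a * a := fun y => by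
    have w0 := logisticWeight_pos (a * y)
    have w1 := logisticWeight_lt_one (a * y)
    have haa : 0 < 2 * a * a := by positivity
    have hk1 : |k y| ≤ 1 + 2 * a * a := by
      simp only [hk]
      rw [abs_le]; constructor <;> nlinarith
    rw [hf, abs_mul, abs_of_nonneg (sq_nonneg _)]
    calc _ ≤ 1 * |k y| := by
          gcongr
          exact pow_le_one₀ w0.le w1.le
      _ ≤ _ := by linarith
  have hf0 : ∫ y, f y ∂(gaussianReal a 1) = 0 := h0
  have hfi := integrable_gaussianReal_of_bounded hfm _ hfC a
  have hpos : ∀ g : ℝ → ℝ, (∀ y, 0 < g y) → Integrable g (gaussianReal a 1) →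
      0 < ∫ y, g y ∂(gaussianReal a 1) := by
    intro g hg hgi
    rw [integral_pos_iff_support_of_nonneg (fun y => (hg y).le) hgi]
    have : Function.support g = Set.univ := by
      ext y; simp [(hg y).ne']
    simp [this]
  have ex1 : ∃ y, k y ≤ 0 := by
    by_contra! h
    have := hpos f (fun y => mul_pos (pow_pos (logisticWeight_pos _) 2) (h y)) hfi
    linarith
  have ex2 : ∃ y, 0 ≤ k y := by
    by_contra! h
    have := hpos (fun y => -f y) (fun y => neg_pos.2
      (mul_neg_of_pos_of_neg (pow_pos (logisticWeight_pos _) 2) (h y))) hfi.neg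
    rw [integral_neg] at this
    linarith
  obtain ⟨y₁, hy₁⟩ := ex1
  obtain ⟨y₂, hy₂⟩ := ex2
  obtain ⟨y₀, hy₀⟩ := mem_range_of_exists_le_of_exists_ge hkc ⟨y₁, hy₁⟩ ⟨y₂, hy₂⟩
  have hsign := mul_integral_gaussianReal_nonpos hfm _ hfC a y₀
    (fun y hy => mul_nonneg (sq_nonneg _) (hy₀ ▸ hka hy))
    (fun y hy => mul_nonpos_of_nonneg_of_nonpos (sq_nonneg _) (hy₀ ▸ hka hy)) hf0 t
  have i2 : Integrable (fun y => logisticWeight (a * y) ^ 2 *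
      (1 - logisticWeight (a * y))) (gaussianReal t 1) :=
    integrable_gaussianReal_of_bounded (by fun_prop) 1
      (fun y => abs_logisticWeight_sq_mul_le _) t
  have e : logisticScore a t = (∫ y, f y ∂(gaussianReal t 1)) - 2 * a * (t - a) *
      ∫ y, logisticWeight (a * y) ^ 2 * (1 - logisticWeight (a * y)) ∂(gaussianReal t 1) := by
    rw [logisticScore, ← integral_const_mul,
      ← integral_sub (integrable_gaussianReal_of_bounded hfm _ hfC t) (i2.const_mul _)]
    congr 1
    ext y
    simp only [hf, hk]
    ring
  have hI : 0 ≤ ∫ y, logisticWeight (a * y) ^ 2 * (1 - logisticWeight (a * y))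
      ∂(gaussianReal t 1) :=
    integral_nonneg fun y =>
      mul_nonneg (sq_nonneg _) (sub_nonneg.2 (logisticWeight_lt_one (a * y)).le)
  rw [e]
  nlinarith [mul_nonneg ha.le (mul_nonneg (sq_nonneg (t - a)) hI)]

/-- If the diagonal `t ↦ logisticRegret t t` is maximal at `a`, so is `logisticRegret a`. -/
lemma logisticRegret_le_of_isMax {a : ℝ} (ha : 0 < a)
    (hmax : ∀ t, 0 ≤ t → logisticRegret t t ≤ logisticRegret a a) {t : ℝ} (ht : 0 ≤ t) :
    logisticRegret a t ≤ logisticRegret a a := by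
  have hloc : IsLocalMax (fun t => logisticRegret t t) a := by
    filter_upwards [lt_mem_nhds ha] with t ht using hmax t ht.le
  have hlocmin : IsLocalMin (fun t => logisticRegret a t - logisticRegret t t) a := by
    filter_upwards [lt_mem_nhds ha] with t ht
    linarith [logisticRegret_self_le a ht]
  have hG := (differentiable_logisticRegret_self a).hasDerivAt
  rw [hloc.deriv_eq_zero] at hG
  have hz := hlocmin.hasDerivAt_eq_zero ((hasDerivAt_logisticRegret a a).sub hG)
  have h0 : logisticScore a a = 0 := by
    rcases mul_eq_zero.1 (by linarith : 2 * a * logisticScore a a = 0) with h | h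
    · linarith
    · exact h
  have hdiff : Differentiable ℝ (logisticRegret a) := fun t =>
    (hasDerivAt_logisticRegret a t).differentiableAt
  have hs : ∀ t, (t - a) * logisticScore a t ≤ 0 := fun t => mul_logisticScore_nonpos ha h0
  rcases le_total t a with hta | hta
  · refine monotoneOn_of_deriv_nonneg (convex_Icc 0 a) hdiff.continuous.continuousOn
      hdiff.differentiableOn (fun x hx => ?_) ⟨ht, hta⟩ ⟨ha.le, le_rfl⟩ hta
    rw [interior_Icc] at hx
    rw [(hasDerivAt_logisticRegret a x).deriv]
    refine mul_nonneg (by linarith [hx.1]) ?_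
    exact nonneg_of_mul_nonpos_right (hs x) (by linarith [hx.2])
  · refine antitoneOn_of_deriv_nonpos (convex_Ici a) hdiff.continuous.continuousOn
      hdiff.differentiableOn (fun x hx => ?_) Set.self_mem_Ici hta hta
    rw [interior_Ici] at hx
    have hx' : a < x := hx
    rw [(hasDerivAt_logisticRegret a x).deriv]
    refine mul_nonpos_of_nonneg_of_nonpos (by linarith) ?_
    exact nonpos_of_mul_nonpos_right (hs x) (by linarith)

lemma rsq_nonneg (δ : ℝ → ℝ) (t : ℝ) : 0 ≤ Rsq δ t :=
  mul_nonneg (sq_nonneg _) (integral_nonneg fun _ => sq_nonneg _)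

lemma integral_twoPointPrior (g : ℝ → ℝ) (t : ℝ) :
    ∫ x, g x ∂(twoPointPrior t) = (g t + g (-t)) / 2 := by
  have hi : ∀ s : ℝ, Integrable g ((2 : ENNReal)⁻¹ • Measure.dirac s) := fun s =>
    (integrable_dirac (by simp)).smul_measure (by simp)
  rw [twoPointPrior, integral_add_measure (hi t) (hi (-t)), integral_smul_measure,
    integral_smul_measure, integral_dirac, integral_dirac]
  simp
  ring

/-- The two-point prior at `±τ*` is least favorable for mean square regret: no prior `π`
has a larger minimal Bayes mean square regret. -/
theorem stmt16 (τs : ℝ) (hτs : 0 < τs)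
    (hmax : ∀ τ : ℝ, 0 ≤ τ →
      τ ^ 2 * ∫ y, (1 / (Real.exp (2 * τ * y) + 1)) ^ 2 ∂(gaussianReal τ 1)
        ≤ τs ^ 2 * ∫ y, (1 / (Real.exp (2 * τs * y) + 1)) ^ 2 ∂(gaussianReal τs 1))
    (π : Measure ℝ) [IsProbabilityMeasure π] :
    minBayesRisk π ≤ minBayesRisk (twoPointPrior τs) := by
  have hmax' : ∀ t, 0 ≤ t → logisticRegret t t ≤ logisticRegret τs τs := fun t ht => by
    simpa only [logisticRegret, logisticWeight, ← mul_assoc] using hmax t ht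
  have hle : ∀ t, Rsq (logisticRule τs) t ≤ logisticRegret τs τs := fun t => by
    rcases le_or_gt 0 t with ht | ht
    · rw [rsq_logisticRule_of_nonneg τs ht]
      exact logisticRegret_le_of_isMax hτs hmax' ht
    · rw [← neg_neg t, rsq_logisticRule_neg τs (neg_pos.2 ht)]
      exact logisticRegret_le_of_isMax hτs hmax' (neg_pos.2 ht).le
  have hupper : minBayesRisk π ≤ logisticRegret τs τs := by
    have hinf : minBayesRisk π ≤ ∫ t, Rsq (logisticRule τs) t ∂π := by
      refine csInf_le ⟨0, ?_⟩ ⟨logisticRule τs, measurable_logisticRule τs,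
        logisticRule_mem_Icc τs, rfl⟩
      rintro r ⟨δ, -, -, rfl⟩
      exact integral_nonneg (rsq_nonneg δ)
    refine hinf.trans ((integral_mono_of_nonneg (Filter.Eventually.of_forall (rsq_nonneg _))
      (integrable_const (logisticRegret τs τs)) (Filter.Eventually.of_forall hle)).trans ?_)
    simp
  refine hupper.trans (le_csInf ⟨_, logisticRule τs, measurable_logisticRule τs,
    logisticRule_mem_Icc τs, rfl⟩ ?_)
  rintro r ⟨δ, hδ, hδ', rfl⟩
  rw [integral_twoPointPrior]
  linarith [two_mul_logisticRegret_le hδ hδ' hτs]
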